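/- arXiv:2001.00858 — 2 statements merged into one kernel-verified Lean document; each statement's English description precedes it below -/
import Mathlib

section
/- Corollary 1: Suppose x : A → ℝ with x ≥ 0, z : A → ℝ, and φ ∈ ℝ with φ ≥ 0 satisfy: (b103) Σ_{j ∈ δ⁺(s)} x_{sj} = m − φ; (b104) x_{is} = 0 for every arc (i,s) ∈ A and x_{tj} = 0 for every arc (t,j) ∈ A; (b105) Σ_{j ∈ δ⁺(i)} x_{ij} = Σ_{j ∈ δ⁻(i)} x_{ji} for all i ∈ S ∪ P; (b106) z_{sj} = d_{sj}·x_{sj} for all j ∈ δ⁺(s); (b107) Σ_{j ∈ δ⁺(i)} z_{ij} − Σ_{j ∈ δ⁻(i)} z_{ji} = Σ_{j ∈ δ⁺(i)} d_{ij}·x_{ij} for all i ∈ S ∪ P; (b108) z_{ij} ≤ (T − R_{jt})·x_{ij} for all (i,j) ∈ A; and (b109) z_{ij} ≥ (R_{si} + d_{ij})·x_{ij} for all (i,j) ∈ A. Then Σ_{(i,j) ∈ A} d_{ij}·x_{ij} ≤ m·T. In other words, the inequality Σ_{(i,j) ∈ A} d_{ij} x_{ij} ≤ mT does not cut off any point of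 the linear relaxation of the formulation 𝓕₁. -/
open Finset

/-- Summing a function over the arcs, grouped by tail. -/
theorem sum_arcs_eq_sum_out {N : Type*} [Fintype N] [DecidableEq N]
    (A : Finset (N × N)) (f : N × N → ℝ) :
    ∑ e ∈ A, f e = ∑ i, ∑ j ∈ univ.filter (fun j => (i, j) ∈ A), f (i, j) :=
  Finset.sum_finset_product A univ _ (by simp)

/-- Summing a function over the arcs, grouped by head. -/
theorem sum_arcs_eq_sum_in {N : Type*} [Fintype N] [DecidableEq N]
    (A : Finset (N × N)) (f : N × N → ℝ) :
    ∑ e ∈ A, f e = ∑ i, ∑ j ∈ univ.filter (fun j => (j, i) ∈ A), f (j, i) :=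
  Finset.sum_finset_product_right A univ _ (by simp)

/-- A sum over all vertices splits into the two terminals and the remaining vertices. -/
theorem sum_univ_eq_terminals_add {N : Type*} [Fintype N] [DecidableEq N]
    {s t : N} (hst : s ≠ t) (g : N → ℝ) :
    ∑ i, g i = g s + g t + ∑ i ∈ univ \ ({s, t} : Finset N), g i := by
  rw [← Finset.sum_sdiff (Finset.subset_univ ({s, t} : Finset N)), Finset.sum_pair hst, add_comm]

/-- Corollary 1: any point of the linear relaxation of the formulation
`𝓕₁` satisfies `Σ_{(i,j)∈A} d_{ij} x_{ij} ≤ m·T`. -/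
theorem corol1_F1_satisfies_mT
    {N : Type*} [Fintype N] [DecidableEq N]
    (A : Finset (N × N)) (s t : N) (S P : Finset N)
    (d : N × N → ℝ) (T m : ℝ) (R : N × N → ℝ)
    (hst : s ≠ t)
    (hSP : Disjoint S P)
    (hpart : S ∪ P = Finset.univ \ ({s, t} : Finset N))
    (hd : ∀ e ∈ A, 0 ≤ d e) (hT : 0 ≤ T) (hm : 0 ≤ m)
    (hR : ∀ u v : N, 0 ≤ R (u, v)) (hRss : R (s, s) = 0)
    (x z : N × N → ℝ) (φ : ℝ)
    (hx : ∀ e ∈ A, 0 ≤ x e) (hφ : 0 ≤ φ)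
    -- (b103)
    (hb103 : ∑ j ∈ univ.filter (fun j => (s, j) ∈ A), x (s, j) = m - φ)
    -- (b104)
    (hb104s : ∀ i : N, (i, s) ∈ A → x (i, s) = 0)
    (hb104t : ∀ j : N, (t, j) ∈ A → x (t, j) = 0)
    -- (b105)
    (hb105 : ∀ i ∈ S ∪ P,
      ∑ j ∈ univ.filter (fun j => (i, j) ∈ A), x (i, j)
        = ∑ j ∈ univ.filter (fun j => (j, i) ∈ A), x (j, i))
    -- (b106)
    (hb106 : ∀ j : N, (s, j) ∈ A → z (s, j) = d (s, j) * x (s, j))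
    -- (b107)
    (hb107 : ∀ i ∈ S ∪ P,
      ∑ j ∈ univ.filter (fun j => (i, j) ∈ A), z (i, j)
        - ∑ j ∈ univ.filter (fun j => (j, i) ∈ A), z (j, i)
      = ∑ j ∈ univ.filter (fun j => (i, j) ∈ A), d (i, j) * x (i, j))
    -- (b108)
    (hb108 : ∀ e ∈ A, z e ≤ (T - R (e.2, t)) * x e)
    -- (b109)
    (hb109 : ∀ e ∈ A, (R (s, e.1) + d e) * x e ≤ z e) :
    ∑ e ∈ A, d e * x e ≤ m * T := by
  have hz : ∀ e ∈ A, x e = 0 → z e = 0 := fun e he h => by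
    have h₁ := hb108 e he
    have h₂ := hb109 e he
    rw [h, mul_zero] at h₁ h₂
    exact le_antisymm h₁ h₂
  rw [hpart] at hb105 hb107
  -- Flow leaving `s` equals flow entering `t`.
  have hflow : ∑ j ∈ univ.filter (fun j => (s, j) ∈ A), x (s, j)
      = ∑ j ∈ univ.filter (fun j => (j, t) ∈ A), x (j, t) := by
    have hbal := (sum_arcs_eq_sum_out A x).symm.trans (sum_arcs_eq_sum_in A x)
    rw [sum_univ_eq_terminals_add hst, sum_univ_eq_terminals_add hst,
      Finset.sum_congr rfl hb105] at hbal
    have hin : ∑ j ∈ univ.filter (fun j => (j, s) ∈ A), x (j, s) = 0 :=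
      Finset.sum_eq_zero fun j hj => hb104s j (by simpa using hj)
    have hout : ∑ j ∈ univ.filter (fun j => (t, j) ∈ A), x (t, j) = 0 :=
      Finset.sum_eq_zero fun j hj => hb104t j (by simpa using hj)
    linarith
  -- The total time equals the accumulated time entering `t`.
  have htime : ∑ e ∈ A, d e * x e = ∑ j ∈ univ.filter (fun j => (j, t) ∈ A), z (j, t) := by
    have hbal := (sum_arcs_eq_sum_out A z).symm.trans (sum_arcs_eq_sum_in A z)
    rw [sum_univ_eq_terminals_add hst, sum_univ_eq_terminals_add hst] at hbal
    have hinner := Finset.sum_congr rfl hb107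
    rw [Finset.sum_sub_distrib] at hinner
    rw [sum_arcs_eq_sum_out A (fun e => d e * x e), sum_univ_eq_terminals_add hst]
    have hin : ∑ j ∈ univ.filter (fun j => (j, s) ∈ A), z (j, s) = 0 :=
      Finset.sum_eq_zero fun j hj => by
        have hj : (j, s) ∈ A := by simpa using hj
        exact hz _ hj (hb104s j hj)
    have hout : ∑ j ∈ univ.filter (fun j => (t, j) ∈ A), z (t, j) = 0 :=
      Finset.sum_eq_zero fun j hj => by
        have hj : (t, j) ∈ A := by simpa using hj
        exact hz _ hj (hb104t j hj)
    have hout_time : ∑ j ∈ univ.filter (fun j => (t, j) ∈ A), d (t, j) * x (t, j) = 0 :=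
      Finset.sum_eq_zero fun j hj => by
        rw [hb104t j (by simpa using hj), mul_zero]
    have hstart : ∑ j ∈ univ.filter (fun j => (s, j) ∈ A), z (s, j)
        = ∑ j ∈ univ.filter (fun j => (s, j) ∈ A), d (s, j) * x (s, j) :=
      Finset.sum_congr rfl fun j hj => hb106 j (by simpa using hj)
    linarith
  calc ∑ e ∈ A, d e * x e
      = ∑ j ∈ univ.filter (fun j => (j, t) ∈ A), z (j, t) := htime
    _ ≤ ∑ j ∈ univ.filter (fun j => (j, t) ∈ A), T * x (j, t) :=
        Finset.sum_le_sum fun j hj => by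
          have hj : (j, t) ∈ A := by simpa using hj
          have hbound := hb108 _ hj
          have hnonneg := mul_nonneg (hR t t) (hx _ hj)
          simp only at hbound
          linarith
    _ = T * (m - φ) := by rw [← Finset.mul_sum, ← hflow, hb103]
    _ ≤ m * T := by linarith [mul_nonneg hT hφ]
end

section
/- Proposition 2 (validity of the conflict cuts (cc00)): Let a feasible solution be given, consisting of routes r₁, …, r_k (k ≤ m), each an s–t directed path of total traverse time at most T, such that every vertex of N ∖ {s,t} lies on at most one route; define x : A → {0,1} and y : N → {0,1} by x_e = 1 iff arc e lies on some route and y_v = 1 iff vertex v lies on some route. Let i, j ∈ N ∖ {s,t} be a conflicting pair and let V ⊆ N be any subset with s ∉ V and i, j ∈ V. Then Σ_{e ∈ δ⁻(V)} x_e ≥ y_i + y_j. -/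
open Finset
open scoped Classical

/-- A route: a directed s–t path (nonempty list of vertices starting at
`s`, ending at `t`, no repeated vertices, consecutive pairs are arcs of
`A`) whose total traverse time is at most `T`. -/
def IsRoute {N : Type*} (A : Finset (N × N)) (d : N × N → ℝ) (T : ℝ)
    (s t : N) (r : List N) : Prop :=
  r ≠ [] ∧ r.head? = some s ∧ r.getLast? = some t ∧ r.Nodup ∧
    List.Chain' (fun u v => (u, v) ∈ A) r ∧ ((r.zip r.tail).map d).sum ≤ T

/-- A path that starts outside `V` and visits a vertex `i ∈ V` other than its last vertex `t`
has an arc entering `V` whose head is not `t`. -/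
theorem exists_entering_arc {N : Type*} (A : Finset (N × N)) (V : Finset N) {t i : N}
    (hit : i ≠ t) (hiV : i ∈ V) :
    ∀ (l : List N) (a : N), a ∉ V → i ∈ a :: l → (a :: l).getLast? = some t →
      (a :: l).Nodup → List.IsChain (fun u v => (u, v) ∈ A) (a :: l) →
      ∃ e ∈ (a :: l).zip l, e ∈ A ∧ e.1 ∉ V ∧ e.2 ∈ V ∧ e.2 ≠ t
  | [], a, ha, hi, _, _, _ => by
    rw [List.mem_singleton] at hi
    exact absurd (hi ▸ hiV) ha
  | b :: l, a, ha, hi, hlast, hnd, hch => by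
    have hib : i ∈ b :: l := by
      rcases List.mem_cons.1 hi with rfl | h
      · exact absurd hiV ha
      · exact h
    rw [List.getLast?_cons_cons] at hlast
    rw [List.isChain_cons_cons] at hch
    by_cases hb : b ∈ V
    · refine ⟨(a, b), by simp, hch.1, ha, hb, ?_⟩
      rintro rfl
      have hil : i ∈ l := (List.mem_cons.1 hib).resolve_left hit
      cases l with
      | nil => simp at hil
      | cons c l =>
        rw [List.getLast?_cons_cons] at hlast
        exact (List.nodup_cons.1 (List.nodup_cons.1 hnd).2).1 (List.mem_of_getLast? hlast)
    · obtain ⟨e, he, h⟩ := exists_entering_arc A V hit hiV l b hb hib hlast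
        (List.nodup_cons.1 hnd).2 hch.2
      exact ⟨e, List.mem_cons_of_mem _ he, h⟩

/-- A route visiting `i ∈ V`, where `s ∉ V` and `i ≠ t`, has an arc entering `V` whose head
is not `t`. -/
theorem IsRoute.exists_entering_arc {N : Type*} {A : Finset (N × N)} {d : N × N → ℝ} {T : ℝ}
    {s t i : N} {r : List N} (hr : IsRoute A d T s t r) {V : Finset N} (hsV : s ∉ V)
    (hit : i ≠ t) (hiV : i ∈ V) (hi : i ∈ r) :
    ∃ e ∈ r.zip r.tail, e ∈ A ∧ e.1 ∉ V ∧ e.2 ∈ V ∧ e.2 ≠ t := by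
  obtain ⟨hne, hhead, hlast, hnd, hch, -⟩ := hr
  cases r with
  | nil => exact absurd rfl hne
  | cons a l =>
    obtain rfl : a = s := by simpa using hhead
    exact _root_.exists_entering_arc A V hit hiV l a hsV hi hlast hnd hch

/-- Proposition 2 (validity of the conflict cuts (cc00)): for a feasible
solution with routes `routes 0, …, routes (K-1)` (K ≤ m), a conflicting
pair `i, j` and any `V ⊆ N` with `s ∉ V` and `i, j ∈ V`, we have
`Σ_{e ∈ δ⁻(V)} x_e ≥ y_i + y_j`. -/
theorem conflict_cut_cc00
    {N : Type*} [Fintype N] [DecidableEq N]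
    (A : Finset (N × N)) (s t : N) (hst : s ≠ t)
    (d : N × N → ℝ) (hd : ∀ e ∈ A, 0 ≤ d e) (T : ℝ) (hT : 0 ≤ T)
    (m K : ℕ) (hK : K ≤ m)
    (routes : Fin K → List N)
    (hroutes : ∀ a : Fin K, IsRoute A d T s t (routes a))
    (hdisj : ∀ v : N, v ≠ s → v ≠ t →
      ∀ a b : Fin K, v ∈ routes a → v ∈ routes b → a = b)
    (x : N × N → ℝ) (y : N → ℝ)
    (hx : ∀ e : N × N,
      x e = if ∃ a : Fin K, e ∈ (routes a).zip (routes a).tail then 1 else 0)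
    (hy : ∀ v : N, y v = if ∃ a : Fin K, v ∈ routes a then 1 else 0)
    (i j : N) (hi_ns : i ≠ s) (hi_nt : i ≠ t) (hj_ns : j ≠ s) (hj_nt : j ≠ t)
    (hij : i ≠ j)
    -- ⟨i,j⟩ is a conflicting pair: no single route contains both
    (hconf : ∀ r : List N, IsRoute A d T s t r → ¬ (i ∈ r ∧ j ∈ r))
    (V : Finset N) (hsV : s ∉ V) (hiV : i ∈ V) (hjV : j ∈ V) :
    y i + y j ≤ ∑ e ∈ A.filter (fun e => e.1 ∉ V ∧ e.2 ∈ V), x e := by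
  have hx0 : ∀ e, 0 ≤ x e := fun e => by rw [hx]; split_ifs <;> norm_num
  have hx1 : ∀ e a, e ∈ (routes a).zip (routes a).tail → x e = 1 := fun e a h => by
    rw [hx, if_pos ⟨a, h⟩]
  have enter : ∀ v, v ≠ t → v ∈ V → ∀ a, v ∈ routes a →
      ∃ e ∈ A.filter (fun e => e.1 ∉ V ∧ e.2 ∈ V),
        e ∈ (routes a).zip (routes a).tail ∧ e.2 ≠ t := by
    intro v hvt hvV a hva
    obtain ⟨e, he, heA, h1, h2, h3⟩ := (hroutes a).exists_entering_arc hsV hvt hvV hva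
    exact ⟨e, mem_filter.2 ⟨heA, h1, h2⟩, he, h3⟩
  have one_le : ∀ v, v ≠ t → v ∈ V → (∃ a, v ∈ routes a) →
      1 ≤ ∑ e ∈ A.filter (fun e => e.1 ∉ V ∧ e.2 ∈ V), x e := by
    rintro v hvt hvV ⟨a, hva⟩
    obtain ⟨e, he, hea, -⟩ := enter v hvt hvV a hva
    exact (hx1 e a hea).symm.le.trans (single_le_sum (fun e _ => hx0 e) he)
  rw [hy i, hy j]
  split_ifs with hi hj hj
  · obtain ⟨a, hia⟩ := hi
    obtain ⟨b, hjb⟩ := hj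
    obtain ⟨e, he, hea, het⟩ := enter i hi_nt hiV a hia
    obtain ⟨f, hf, hfb, -⟩ := enter j hj_nt hjV b hjb
    have hef : e ≠ f := by
      rintro rfl
      have hes : e.2 ≠ s := fun h => hsV (h ▸ (mem_filter.1 he).2.2)
      have hmem : ∀ c, e ∈ (routes c).zip (routes c).tail → e.2 ∈ routes c := fun c h =>
        List.mem_of_mem_tail (List.of_mem_zip (a := e.1) (b := e.2) h).2
      obtain rfl := hdisj e.2 hes het a b (hmem a hea) (hmem b hfb)
      exact hconf _ (hroutes a) ⟨hia, hjb⟩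
    calc (1 : ℝ) + 1 = ∑ g ∈ {e, f}, x g := by
          rw [sum_pair hef, hx1 e a hea, hx1 f b hfb]
      _ ≤ _ := sum_le_sum_of_subset_of_nonneg
          (insert_subset he (singleton_subset_iff.2 hf)) (fun g _ _ => hx0 g)
  · simpa using one_le i hi_nt hiV hi
  · simpa using one_le j hj_nt hjV hj
  · simpa using sum_nonneg fun e _ => hx0 e
end
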